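/- arXiv:1205.2379 — 2 statements merged into one kernel-verified Lean document; each statement's English description precedes it below -/
import Mathlib

section
/- Let D ⊆ ℝ^m be an open set and φ : D → Sym(k, ℝ) a smooth map into the symmetric k×k real matrices. Suppose the largest-eigenvalue function x ↦ λ_max(φ(x)) attains a local maximum value λ at a point x₀ ∈ D. Then for every v ∈ ℝᵏ with φ(x₀)v = λv one has vᵀ(∂ⱼφ)(x₀)v = 0 for every j ∈ {1, …, m}, and ∑_{i,j=1}^m a^{ij} vᵀ(∂ᵢ∂ⱼφ)(x₀)v + ∑_{j=1}^m b^j vᵀ(∂ⱼφ)(x₀)v ≤ 0 for every symmetric positive definite matrix (a^{ij}) and every vector (b^j) ∈ ℝ^m. -/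
/-- First partial derivative `∂u/∂xⱼ` of a scalar function on `ℝ^m`. -/
noncomputable def pd {m : ℕ} (u : (Fin m → ℝ) → ℝ) (j : Fin m) (x : Fin m → ℝ) : ℝ :=
  fderiv ℝ u x (Pi.single j 1)

/-- Second partial derivative `∂²u/∂xᵢ∂xⱼ` of a scalar function on `ℝ^m`. -/
noncomputable def pd2 {m : ℕ} (u : (Fin m → ℝ) → ℝ) (i j : Fin m) (x : Fin m → ℝ) : ℝ :=
  fderiv ℝ (fun y => fderiv ℝ u y (Pi.single j 1)) x (Pi.single i 1)

/-- The quadratic form `vᵀ θ v` of a `k × k` matrix `θ` (given as `Fin k → Fin k → ℝ`). -/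
def quadForm {k : ℕ} (θ : Fin k → Fin k → ℝ) (v : Fin k → ℝ) : ℝ :=
  ∑ i, ∑ j, v i * θ i j * v j

theorem pd_quadForm_aux {m k : ℕ} (θ : (Fin m → ℝ) → Fin k → Fin k → ℝ) (v : Fin k → ℝ)
    (j : Fin m) (x : Fin m → ℝ) (h : ∀ p q, DifferentiableAt ℝ (fun y => θ y p q) x) :
    pd (fun y => quadForm (θ y) v) j x = quadForm (fun p q => pd (fun y => θ y p q) j x) v := by
  have h1 : HasFDerivAt (fun y => quadForm (θ y) v)
      (∑ p, ∑ q, v q • (v p • fderiv ℝ (fun y => θ y p q) x)) x := by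
    unfold quadForm
    refine HasFDerivAt.fun_sum fun p _ => HasFDerivAt.fun_sum fun q _ => ?_
    exact ((h p q).hasFDerivAt.const_mul (v p)).mul_const (v q)
  unfold pd
  rw [h1.fderiv]
  simp only [quadForm, sum_apply, smul_apply, smul_eq_mul]
  exact Finset.sum_congr rfl fun p _ => Finset.sum_congr rfl fun q _ => by ring

theorem hess_nonpos_aux {m : ℕ} (u : (Fin m → ℝ) → ℝ) (x₀ : Fin m → ℝ)
    (hu : ContDiffAt ℝ 2 u x₀) (hmax : IsLocalMax u x₀) (ξ : Fin m → ℝ) :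
    fderiv ℝ (fderiv ℝ u) x₀ ξ ξ ≤ 0 := by
  by_contra! hpos
  set g : ℝ → ℝ := fun t => u (x₀ + t • ξ) with hg
  have hl : ∀ t : ℝ, HasDerivAt (fun t : ℝ => x₀ + t • ξ) ξ t := fun t => by
    simpa using ((hasDerivAt_id t).smul_const ξ).const_add x₀
  have hc : Filter.Tendsto (fun t : ℝ => x₀ + t • ξ) (nhds 0) (nhds x₀) := by
    have := (hl 0).continuousAt.tendsto
    simpa using this
  have hd : ∀ᶠ y in nhds x₀, DifferentiableAt ℝ u y := by
    filter_upwards [hu.eventually (by simp)] with y hy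
    exact hy.differentiableAt (by simp)
  have hg1 : deriv g =ᶠ[nhds 0] fun t => fderiv ℝ u (x₀ + t • ξ) ξ := by
    filter_upwards [hc.eventually hd] with t ht
    exact (ht.hasFDerivAt.comp_hasDerivAt t (hl t)).deriv
  have hd2 : DifferentiableAt ℝ (fderiv ℝ u) x₀ :=
    (hu.fderiv_right (m := 1) (by norm_num)).differentiableAt (by simp)
  have hg2 : HasDerivAt (fun t : ℝ => fderiv ℝ u (x₀ + t • ξ) ξ)
      (fderiv ℝ (fderiv ℝ u) x₀ ξ ξ) 0 := by
    have h0 : HasFDerivAt (fderiv ℝ u) (fderiv ℝ (fderiv ℝ u) x₀) (x₀ + (0 : ℝ) • ξ) := by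
      simpa using hd2.hasFDerivAt
    have h2 : HasFDerivAt (fun y => fderiv ℝ u y ξ)
        ((ContinuousLinearMap.apply ℝ ℝ ξ).comp (fderiv ℝ (fderiv ℝ u) x₀))
        (x₀ + (0 : ℝ) • ξ) :=
      (ContinuousLinearMap.apply ℝ ℝ ξ).hasFDerivAt.comp _ h0
    exact h2.comp_hasDerivAt (0 : ℝ) (hl 0)
  have hg2' : deriv (deriv g) 0 = fderiv ℝ (fderiv ℝ u) x₀ ξ ξ := by
    rw [hg1.deriv_eq, hg2.deriv]
  have hg0 : deriv g 0 = 0 := by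
    rw [hg1.eq_of_nhds]
    simp [hmax.fderiv_eq_zero]
  have hgc : ContinuousAt g 0 := by
    have : ContinuousAt u (x₀ + (0 : ℝ) • ξ) := by simpa using hu.continuousAt
    exact ContinuousAt.comp (f := fun t : ℝ => x₀ + t • ξ) this (hl 0).continuousAt
  have hmin : IsLocalMin g 0 :=
    isLocalMin_of_deriv_deriv_pos (by rw [hg2']; exact hpos) hg0 hgc
  have hconst : g =ᶠ[nhds 0] fun _ => g 0 := by
    filter_upwards [hmin, hc.eventually hmax] with t h1 h2
    refine le_antisymm ?_ h1
    simpa [hg] using h2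
  have hz : deriv (deriv g) 0 = 0 := by
    rw [hconst.deriv.deriv_eq]
    simp
  rw [hg2'] at hz
  exact hpos.ne' hz

theorem trace_nonpos_aux {m : ℕ} (a : Fin m → Fin m → ℝ) (H : Fin m → Fin m → ℝ)
    (hs : ∀ i j, a i j = a j i)
    (ha : ∀ ξ : Fin m → ℝ, ξ ≠ 0 → 0 < ∑ i, ∑ j, a i j * ξ i * ξ j)
    (hH : ∀ ξ : Fin m → ℝ, ∑ i, ∑ j, ξ i * ξ j * H i j ≤ 0) :
    ∑ i, ∑ j, a i j * H i j ≤ 0 := by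
  have hps : (Matrix.of a).PosSemidef := by
    refine Matrix.PosSemidef.of_dotProduct_mulVec_nonneg ?_ ?_
    · ext i j
      simp [hs j i]
    · intro ξ
      have h0 : star ξ ⬝ᵥ (Matrix.of a).mulVec ξ = ∑ i, ∑ j, a i j * ξ i * ξ j := by
        simp only [dotProduct, Matrix.mulVec, Finset.mul_sum]
        exact Finset.sum_congr rfl fun p _ => Finset.sum_congr rfl fun q _ => by
          simp; ring
      rw [h0]
      by_cases h : ξ = 0
      · simp [h]
      · exact (ha ξ h).le
  obtain ⟨B, hB⟩ : ∃ B : Matrix (Fin m) (Fin m) ℝ, Matrix.of a = B.conjTranspose * B :=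
    by
    open scoped MatrixOrder in
    obtain ⟨B, hB⟩ := CStarAlgebra.nonneg_iff_eq_star_mul_self.mp hps.nonneg
    exact ⟨B, hB⟩
  have hab : ∀ i j, a i j = ∑ l, B l i * B l j := fun i j => by
    have := congrFun (congrFun hB i) j
    simpa [Matrix.mul_apply] using this
  have : ∑ i, ∑ j, a i j * H i j = ∑ l, ∑ i, ∑ j, B l i * B l j * H i j := by
    simp only [hab, Finset.sum_mul]
    have h1 : ∀ i, ∑ j, ∑ l, B l i * B l j * H i j = ∑ l, ∑ j, B l i * B l j * H i j :=
      fun i => Finset.sum_comm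
    simp only [h1]
    exact Finset.sum_comm
  rw [this]
  exact Finset.sum_nonpos fun l _ => hH (B l)

/-- **Second derivative criterion (largest eigenvalue).**  Let `φ : D → Sym(k, ℝ)` be a
smooth map of symmetric matrices whose largest-eigenvalue function attains a local maximum
value `lam` at `x₀ ∈ D` (expressed by: `vᵀ φ(x) v ≤ lam ‖v‖²` for all `x` near `x₀` and
`lam` is an eigenvalue of `φ(x₀)`).  Then for every eigenvector `v` of `φ(x₀)` with
eigenvalue `lam` one has `vᵀ (∂ⱼφ)(x₀) v = 0` for all `j`, and
`∑ᵢⱼ aⁱʲ vᵀ(∂ᵢ∂ⱼφ)(x₀)v + ∑ⱼ bʲ vᵀ(∂ⱼφ)(x₀)v ≤ 0` for every symmetric positive definite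
matrix `(aⁱʲ)` and every vector `(bʲ)`. -/
theorem second_derivative_criterion_max
    (m k : ℕ) (D : Set (Fin m → ℝ)) (hDo : IsOpen D)
    (φ : (Fin m → ℝ) → Fin k → Fin k → ℝ)
    (hφsmooth : ∀ i j, ContDiffOn ℝ (⊤ : ℕ∞) (fun x => φ x i j) D)
    (hφsym : ∀ x ∈ D, ∀ i j, φ x i j = φ x j i)
    (x₀ : Fin m → ℝ) (hx₀ : x₀ ∈ D) (lam : ℝ)
    (hlocmax : ∃ ε > (0 : ℝ), ∀ x ∈ D, dist x x₀ < ε →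
      ∀ v : Fin k → ℝ, quadForm (φ x) v ≤ lam * ∑ i, (v i) ^ 2)
    (hattained : ∃ v₀ : Fin k → ℝ, v₀ ≠ 0 ∧ ∀ i, ∑ j, φ x₀ i j * v₀ j = lam * v₀ i) :
    ∀ v : Fin k → ℝ, (∀ i, ∑ j, φ x₀ i j * v j = lam * v i) →
      (∀ j : Fin m, quadForm (fun p q => pd (fun y => φ y p q) j x₀) v = 0) ∧
      (∀ (a : Fin m → Fin m → ℝ) (b : Fin m → ℝ),
        (∀ i j, a i j = a j i) →
        (∀ ξ : Fin m → ℝ, ξ ≠ 0 → 0 < ∑ i, ∑ j, a i j * ξ i * ξ j) →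
        (∑ i, ∑ j, a i j * quadForm (fun p q => pd2 (fun y => φ y p q) i j x₀) v) +
          (∑ j, b j * quadForm (fun p q => pd (fun y => φ y p q) j x₀) v) ≤ 0) := by
  intro v hv
  obtain ⟨ε, hε, hloc⟩ := hlocmax
  set u : (Fin m → ℝ) → ℝ := fun y => quadForm (φ y) v with hu
  have hDn : D ∈ nhds x₀ := hDo.mem_nhds hx₀
  have hφat : ∀ x ∈ D, ∀ p q, ContDiffAt ℝ 2 (fun y => φ y p q) x := fun x hx p q =>
    ((hφsmooth p q).contDiffAt (hDo.mem_nhds hx)).of_le (by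
      have h : ((2 : ℕ∞) : WithTop ℕ∞) ≤ ((⊤ : ℕ∞) : WithTop ℕ∞) :=
        WithTop.coe_le_coe.mpr le_top
      exact h)
  have huc : ContDiffAt ℝ 2 u x₀ := by
    simp only [hu, quadForm]
    refine ContDiffAt.sum fun p _ => ContDiffAt.sum fun q _ => ?_
    exact (contDiffAt_const.mul (hφat x₀ hx₀ p q)).mul contDiffAt_const
  have hu0 : u x₀ = lam * ∑ i, (v i) ^ 2 := by
    simp only [hu, quadForm, Finset.mul_sum]
    refine Finset.sum_congr rfl fun i _ => ?_
    have : ∑ j, v i * φ x₀ i j * v j = v i * ∑ j, φ x₀ i j * v j := by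
      rw [Finset.mul_sum]
      exact Finset.sum_congr rfl fun j _ => by ring
    rw [this, hv i]
    ring
  have hmax : IsLocalMax u x₀ := by
    filter_upwards [hDn, Metric.ball_mem_nhds x₀ hε] with x hx hxe
    rw [hu0]
    exact hloc x hx hxe v
  have hpd : ∀ x ∈ D, ∀ j, pd u j x = quadForm (fun p q => pd (fun y => φ y p q) j x) v :=
    fun x hx j => pd_quadForm_aux φ v j x fun p q =>
      (hφat x hx p q).differentiableAt (by simp)
  have h1 : ∀ j : Fin m, quadForm (fun p q => pd (fun y => φ y p q) j x₀) v = 0 := by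
    intro j
    rw [← hpd x₀ hx₀ j]
    simp [pd, hmax.fderiv_eq_zero]
  refine ⟨h1, fun a b hs ha => ?_⟩
  have hdf : ∀ w : (Fin m → ℝ) → ℝ, ContDiffAt ℝ 2 w x₀ →
      DifferentiableAt ℝ (fderiv ℝ w) x₀ := fun w hw =>
    (hw.fderiv_right (m := 1) (by norm_num)).differentiableAt (by simp)
  have hpd2 : ∀ i j, quadForm (fun p q => pd2 (fun y => φ y p q) i j x₀) v =
      fderiv ℝ (fderiv ℝ u) x₀ (Pi.single i 1) (Pi.single j 1) := by
    intro i j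
    have e1 := pd_quadForm_aux (fun y p q => pd (fun z => φ z p q) j y) v i x₀ fun p q =>
      (hdf _ (hφat x₀ hx₀ p q)).clm_apply (differentiableAt_const _)
    have e2 : (fun y => quadForm (fun p q => pd (fun z => φ z p q) j y) v) =ᶠ[nhds x₀]
        fun y => fderiv ℝ u y (Pi.single j 1) := by
      filter_upwards [hDn] with y hy
      exact (hpd y hy j).symm
    refine e1.symm.trans ?_
    unfold pd at e2 ⊢
    rw [e2.fderiv_eq, fderiv_clm_apply (hdf u huc) (differentiableAt_const _)]
    simp
  simp only [h1, hpd2, mul_zero, Finset.sum_const_zero, add_zero]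
  refine trace_nonpos_aux a _ hs ha fun ξ => ?_
  have hξ := hess_nonpos_aux u x₀ huc hmax ξ
  have hsum : ξ = ∑ i, ξ i • (Pi.single i (1 : ℝ) : Fin m → ℝ) := by
    simpa using pi_eq_sum_univ' ξ
  refine le_of_eq_of_le ?_ hξ
  conv_rhs => rw [hsum]
  simp only [map_sum, map_smul, sum_apply, smul_apply,
    smul_eq_mul, Finset.mul_sum]
  rw [Finset.sum_comm]
  exact Finset.sum_congr rfl fun p _ => Finset.sum_congr rfl fun q _ => by ring
end

section
/- Let D ⊆ ℝ^m be an open set and φ : D → Sym(k, ℝ) a smooth map into the symmetric k×k real matrices. Suppose the smallest-eigenvalue function x ↦ λ_min(φ(x)) attains a local minimum value λ at a point x₀ ∈ D. Then for every v ∈ ℝᵏ with φ(x₀)v = λv one has vᵀ(∂ⱼφ)(x₀)v = 0 for every j ∈ {1, …, m}, and ∑_{i,j=1}^m a^{ij} vᵀ(∂ᵢ∂ⱼφ)(x₀)v + ∑_{j=1}^m b^j vᵀ(∂ⱼφ)(x₀)v ≥ 0 for every symmetric positive definite matrix (a^{ij}) and every vector (b^j) ∈ ℝ^m. -/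
theorem aux_second {m : ℕ} (f : (Fin m → ℝ) → ℝ) (x₀ : Fin m → ℝ) (hf : ContDiffAt ℝ 2 f x₀)
    (hmin : IsLocalMin f x₀) (ξ : Fin m → ℝ) : 0 ≤ fderiv ℝ (fderiv ℝ f) x₀ ξ ξ := by
  have hev : ∀ᶠ y in nhds x₀, DifferentiableAt ℝ f y := by
    filter_upwards [hf.eventually (by simp)] with y hy
    exact hy.differentiableAt (by simp)
  have hd2 : DifferentiableAt ℝ (fderiv ℝ f) x₀ :=
    (hf.fderiv_right (m := 1) (by norm_num)).differentiableAt (by simp)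
  have hl : ∀ t : ℝ, HasDerivAt (fun t : ℝ => x₀ + t • ξ) ξ t := fun t => by
    simpa using ((hasDerivAt_id t).smul_const ξ).const_add x₀
  have hc : Filter.Tendsto (fun t : ℝ => x₀ + t • ξ) (nhds 0) (nhds x₀) := by
    have := (hl 0).continuousAt.tendsto
    simpa using this
  have h1 : ∀ᶠ t in nhds (0 : ℝ), deriv (fun t : ℝ => f (x₀ + t • ξ)) t
      = fderiv ℝ f (x₀ + t • ξ) ξ := by
    filter_upwards [hc.eventually hev] with t ht
    exact (ht.hasFDerivAt.comp_hasDerivAt t (hl t)).deriv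
  have h2 : deriv (deriv (fun t : ℝ => f (x₀ + t • ξ))) 0 = fderiv ℝ (fderiv ℝ f) x₀ ξ ξ := by
    have e : deriv (fun t : ℝ => f (x₀ + t • ξ)) =ᶠ[nhds 0] fun t => fderiv ℝ f (x₀ + t • ξ) ξ := h1
    rw [e.deriv_eq]
    have hd2' : HasFDerivAt (fderiv ℝ f) (fderiv ℝ (fderiv ℝ f) x₀) (x₀ + (0:ℝ) • ξ) := by
      simpa using hd2.hasFDerivAt
    have h3 : HasFDerivAt (fun y => fderiv ℝ f y ξ)
        ((ContinuousLinearMap.apply ℝ ℝ ξ).comp (fderiv ℝ (fderiv ℝ f) x₀)) (x₀ + (0:ℝ) • ξ) :=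
      (ContinuousLinearMap.apply ℝ ℝ ξ).hasFDerivAt.comp _ hd2'
    have h4 := (h3.comp_hasDerivAt (0:ℝ) (hl 0)).deriv
    exact h4
  rw [← h2]
  set g : ℝ → ℝ := fun t : ℝ => f (x₀ + t • ξ) with hg
  have hgmin : IsLocalMin g 0 := by
    have := hc.eventually hmin
    filter_upwards [this] with t ht
    simpa [hg] using ht
  by_contra! hneg
  have hgc : ContinuousAt g 0 := by
    have h : ContinuousAt f (x₀ + (0:ℝ) • ξ) := by simpa using hf.continuousAt
    exact ContinuousAt.comp (g := f) h (hl 0).continuousAt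
  have hmax : IsLocalMax g 0 :=
    isLocalMax_of_deriv_deriv_neg hneg hgmin.deriv_eq_zero hgc
  have hconst : g =ᶠ[nhds 0] fun _ => g 0 := by
    filter_upwards [hgmin, hmax] with t h1 h2
    exact le_antisymm h2 h1
  have : deriv (deriv g) 0 = 0 := by
    rw [hconst.deriv.deriv_eq]; simp
  linarith

open scoped MatrixOrder Matrix.Norms.L2Operator in
theorem aux_trace {m : ℕ} (L : (Fin m → ℝ) →L[ℝ] (Fin m → ℝ) →L[ℝ] ℝ)
    (hL : ∀ ξ, 0 ≤ L ξ ξ) (a : Fin m → Fin m → ℝ) (hs : ∀ i j, a i j = a j i)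
    (hp : ∀ ξ : Fin m → ℝ, ξ ≠ 0 → 0 < ∑ i, ∑ j, a i j * ξ i * ξ j) :
    0 ≤ ∑ i, ∑ j, a i j * L (Pi.single i 1) (Pi.single j 1) := by
  have hA : (Matrix.of a).PosSemidef := by
    refine Matrix.PosSemidef.of_dotProduct_mulVec_nonneg ?_ ?_
    · ext i j; simpa using hs j i
    · intro ξ
      have e : star ξ ⬝ᵥ (Matrix.of a).mulVec ξ = ∑ i, ∑ j, a i j * ξ i * ξ j := by
        simp only [dotProduct, Matrix.mulVec, Finset.mul_sum]
        refine Finset.sum_congr rfl fun i _ => Finset.sum_congr rfl fun j _ => ?_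
        simp; ring
      rw [e]
      by_cases h : ξ = 0
      · simp [h]
      · exact (hp ξ h).le
  obtain ⟨B, hB⟩ := CStarAlgebra.nonneg_iff_eq_star_mul_self.mp hA.nonneg
  have ha : ∀ i j, a i j = ∑ r, B r i * B r j := fun i j => by
    have := congrFun (congrFun hB i) j
    simpa [Matrix.mul_apply, Matrix.star_apply] using this
  have key : ∀ r, L (B r) (B r) = ∑ i, ∑ j, B r i * B r j * L (Pi.single i 1) (Pi.single j 1) := by
    intro r
    have hb : B r = ∑ i, B r i • (Pi.single i 1 : Fin m → ℝ) := pi_eq_sum_univ' (B r)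
    conv_lhs => rw [hb]
    simp only [map_sum, map_smul, _root_.sum_apply, _root_.smul_apply,
      smul_eq_mul, Finset.mul_sum]
    rw [Finset.sum_comm]
    refine Finset.sum_congr rfl fun i _ => Finset.sum_congr rfl fun j _ => ?_
    ring
  have : ∑ i, ∑ j, a i j * L (Pi.single i 1) (Pi.single j 1) = ∑ r, L (B r) (B r) := by
    simp only [key, ha, Finset.sum_mul]
    symm
    rw [Finset.sum_comm]
    exact Finset.sum_congr rfl fun i _ => Finset.sum_comm
  rw [this]
  exact Finset.sum_nonneg fun r _ => hL _

/-- **Second derivative criterion (smallest eigenvalue).**  Let `φ : D → Sym(k, ℝ)` be a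
smooth map of symmetric matrices whose smallest-eigenvalue function attains a local minimum
value `lam` at `x₀ ∈ D` (expressed by: `vᵀ φ(x) v ≥ lam ‖v‖²` for all `x` near `x₀` and
`lam` is an eigenvalue of `φ(x₀)`).  Then for every eigenvector `v` of `φ(x₀)` with
eigenvalue `lam` one has `vᵀ (∂ⱼφ)(x₀) v = 0` for all `j`, and
`∑ᵢⱼ aⁱʲ vᵀ(∂ᵢ∂ⱼφ)(x₀)v + ∑ⱼ bʲ vᵀ(∂ⱼφ)(x₀)v ≥ 0` for every symmetric positive definite
matrix `(aⁱʲ)` and every vector `(bʲ)`. -/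
theorem second_derivative_criterion_min
    (m k : ℕ) (D : Set (Fin m → ℝ)) (hDo : IsOpen D)
    (φ : (Fin m → ℝ) → Fin k → Fin k → ℝ)
    (hφsmooth : ∀ i j, ContDiffOn ℝ (⊤ : ℕ∞) (fun x => φ x i j) D)
    (hφsym : ∀ x ∈ D, ∀ i j, φ x i j = φ x j i)
    (x₀ : Fin m → ℝ) (hx₀ : x₀ ∈ D) (lam : ℝ)
    (hlocmin : ∃ ε > (0 : ℝ), ∀ x ∈ D, dist x x₀ < ε →
      ∀ v : Fin k → ℝ, lam * ∑ i, (v i) ^ 2 ≤ quadForm (φ x) v)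
    (hattained : ∃ v₀ : Fin k → ℝ, v₀ ≠ 0 ∧ ∀ i, ∑ j, φ x₀ i j * v₀ j = lam * v₀ i) :
    ∀ v : Fin k → ℝ, (∀ i, ∑ j, φ x₀ i j * v j = lam * v i) →
      (∀ j : Fin m, quadForm (fun p q => pd (fun y => φ y p q) j x₀) v = 0) ∧
      (∀ (a : Fin m → Fin m → ℝ) (b : Fin m → ℝ),
        (∀ i j, a i j = a j i) →
        (∀ ξ : Fin m → ℝ, ξ ≠ 0 → 0 < ∑ i, ∑ j, a i j * ξ i * ξ j) →
        0 ≤ (∑ i, ∑ j, a i j * quadForm (fun p q => pd2 (fun y => φ y p q) i j x₀) v) +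
          (∑ j, b j * quadForm (fun p q => pd (fun y => φ y p q) j x₀) v)) := by
  intro v hv
  obtain ⟨ε, hε, hmin⟩ := hlocmin
  have hD : D ∈ nhds x₀ := hDo.mem_nhds hx₀
  have hcd : ∀ y ∈ D, ∀ p q, ContDiffAt ℝ 2 (fun x => φ x p q) y := fun y hy p q =>
    ((hφsmooth p q).contDiffAt (hDo.mem_nhds hy)).of_le (WithTop.coe_le_coe.mpr (le_top : (2 : ℕ∞) ≤ ⊤))
  have hdf : ∀ y ∈ D, ∀ p q, DifferentiableAt ℝ (fun x => φ x p q) y := fun y hy p q =>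
    (hcd y hy p q).differentiableAt (by simp)
  have hdd : ∀ p q, DifferentiableAt ℝ (fderiv ℝ (fun x => φ x p q)) x₀ := fun p q =>
    ((hcd x₀ hx₀ p q).fderiv_right (m := 1) (by norm_num)).differentiableAt (by simp)
  set f : (Fin m → ℝ) → ℝ := fun y => quadForm (φ y) v with hf
  have hfc : ContDiffAt ℝ 2 f x₀ := by
    simp only [hf, quadForm]
    refine ContDiffAt.sum fun p _ => ContDiffAt.sum fun q _ => ?_
    exact (contDiffAt_const.mul (hcd x₀ hx₀ p q)).mul contDiffAt_const
  have hfx : f x₀ = lam * ∑ i, (v i) ^ 2 := by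
    simp only [hf, quadForm, Finset.mul_sum]
    refine Finset.sum_congr rfl fun i _ => ?_
    calc ∑ j, v i * φ x₀ i j * v j = v i * ∑ j, φ x₀ i j * v j := by
          rw [Finset.mul_sum]; exact Finset.sum_congr rfl fun j _ => by ring
      _ = _ := by rw [hv i]; ring
  have hlm : IsLocalMin f x₀ := by
    filter_upwards [hD, Metric.ball_mem_nhds x₀ hε] with y hy hy2
    rw [hfx]; exact hmin y hy hy2 v
  have hfd : ∀ y ∈ D, HasFDerivAt f
      (∑ p, ∑ q, (v p * v q) • fderiv ℝ (fun x => φ x p q) y) y := by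
    intro y hy
    have e : f = fun y => ∑ p, ∑ q, (v p * v q) • φ y p q := by
      funext y
      simp only [hf, quadForm, smul_eq_mul]
      exact Finset.sum_congr rfl fun p _ => Finset.sum_congr rfl fun q _ => by ring
    rw [e]
    exact HasFDerivAt.fun_sum fun p _ => HasFDerivAt.fun_sum fun q _ =>
      (hdf y hy p q).hasFDerivAt.const_smul (v p * v q)
  have hfd2 : fderiv ℝ (fderiv ℝ f) x₀ =
      ∑ p, ∑ q, (v p * v q) • fderiv ℝ (fderiv ℝ (fun x => φ x p q)) x₀ := by
    have e : fderiv ℝ f =ᶠ[nhds x₀]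
        fun y => ∑ p, ∑ q, (v p * v q) • fderiv ℝ (fun x => φ x p q) y := by
      filter_upwards [hD] with y hy
      exact (hfd y hy).fderiv
    rw [e.fderiv_eq]
    exact (HasFDerivAt.fun_sum fun p _ => HasFDerivAt.fun_sum fun q _ =>
      (hdd p q).hasFDerivAt.const_smul (v p * v q)).fderiv
  have hfirst : ∀ j : Fin m, quadForm (fun p q => pd (fun y => φ y p q) j x₀) v = 0 := by
    intro j
    have h0 := hlm.fderiv_eq_zero
    rw [(hfd x₀ hx₀).fderiv] at h0
    have h1 := congrArg (fun L : (Fin m → ℝ) →L[ℝ] ℝ => L (Pi.single j 1)) h0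
    simp only [_root_.sum_apply, _root_.smul_apply, smul_eq_mul,
      _root_.zero_apply] at h1
    rw [← h1]
    simp only [quadForm, pd]
    exact Finset.sum_congr rfl fun p _ => Finset.sum_congr rfl fun q _ => by ring
  refine ⟨hfirst, fun a b hs hp => ?_⟩
  have hsecond : ∀ i j : Fin m, quadForm (fun p q => pd2 (fun y => φ y p q) i j x₀) v
      = fderiv ℝ (fderiv ℝ f) x₀ (Pi.single i 1) (Pi.single j 1) := by
    intro i j
    rw [hfd2]
    simp only [_root_.sum_apply, _root_.smul_apply, smul_eq_mul,
      quadForm]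
    refine Finset.sum_congr rfl fun p _ => Finset.sum_congr rfl fun q _ => ?_
    have : pd2 (fun y => φ y p q) i j x₀ =
        fderiv ℝ (fderiv ℝ (fun x => φ x p q)) x₀ (Pi.single i 1) (Pi.single j 1) := by
      unfold pd2
      rw [fderiv_clm_apply (hdd p q) (differentiableAt_const _)]
      simp
    rw [this]; ring
  simp only [hfirst, hsecond, mul_zero, Finset.sum_const_zero, add_zero]
  exact aux_trace _ (aux_second f x₀ hfc hlm) a hs hp
end
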